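/- arXiv:2008.09754 — 2 statements merged into one kernel-verified Lean document; each statement's English description precedes it below -/
import Mathlib

section
/- For every spider graph with d ≥ 3 legs having at least one leg of length 1, the local antimagic chromatic number equals d+1. -/
open SimpleGraph

/-- The induced vertex sum of an edge labeling. -/
noncomputable def vertexSum {V : Type*} (G : SimpleGraph V) (f : Sym2 V → ℕ) (x : V) : ℕ :=
  ∑ᶠ y ∈ G.neighborSet x, f s(x, y)

/-- `f` is a local antimagic labeling of `G`. -/
def IsLocalAntimagic {V : Type*} (G : SimpleGraph V) (f : Sym2 V → ℕ) : Prop :=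
  Set.BijOn f G.edgeSet (Set.Icc 1 G.edgeSet.ncard) ∧
  ∀ ⦃x y : V⦄, G.Adj x y → vertexSum G f x ≠ vertexSum G f y

/-- The number of distinct induced vertex labels of `f`. -/
noncomputable def colorCount {V : Type*} (G : SimpleGraph V) (f : Sym2 V → ℕ) : ℕ :=
  (Set.range (vertexSum G f)).ncard

/-- The local antimagic chromatic number. -/
noncomputable def chiLA {V : Type*} (G : SimpleGraph V) : ℕ :=
  sInf {n | ∃ f : Sym2 V → ℕ, IsLocalAntimagic G f ∧ colorCount G f = n}

/-- A pendant vertex: a vertex of degree 1. -/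
def IsPendant {V : Type*} (G : SimpleGraph V) (x : V) : Prop :=
  (G.neighborSet x).ncard = 1

/-- A pendant edge: an edge incident to a pendant vertex. -/
def IsPendantEdge {V : Type*} (G : SimpleGraph V) (e : Sym2 V) : Prop :=
  e ∈ G.edgeSet ∧ ∃ x ∈ e, IsPendant G x

/-- The spider graph with `d` legs of lengths `y i`: the core is `none`, and leg `i`
consists of vertices `some ⟨i, j⟩` for `j : Fin (y i)`, forming a path from the core. -/
def spider (d : ℕ) (y : Fin d → ℕ) : SimpleGraph (Option (Σ i : Fin d, Fin (y i))) :=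
  SimpleGraph.fromRel (fun u v =>
    ∃ (i : Fin d) (j : Fin (y i)), (u = none ∧ v = some ⟨i, j⟩ ∧ (j : ℕ) = 0) ∨
      (∃ k : Fin (y i), u = some ⟨i, j⟩ ∧ v = some ⟨i, k⟩ ∧ (j : ℕ) + 1 = (k : ℕ)))

namespace Spider

variable {d : ℕ} {y : Fin d → ℕ}

/-- The neighbour of a non-core vertex on the side of the core. -/
def parent (x : Σ i : Fin d, Fin (y i)) : Option (Σ i : Fin d, Fin (y i)) :=
  if (x.2 : ℕ) = 0 then none else some ⟨x.1, ⟨x.2 - 1, by omega⟩⟩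

/-- The edge joining a non-core vertex to its parent. -/
def parentEdge (x : Σ i : Fin d, Fin (y i)) : Sym2 (Option (Σ i : Fin d, Fin (y i))) :=
  s(parent x, some x)

/-- The last vertex of a leg. -/
def leaf (hy : ∀ i, 1 ≤ y i) (i : Fin d) : Σ i : Fin d, Fin (y i) :=
  ⟨i, ⟨y i - 1, Nat.sub_lt (hy i) one_pos⟩⟩

/-- The first vertex of a leg. -/
def base (hy : ∀ i, 1 ≤ y i) (i : Fin d) : Σ i : Fin d, Fin (y i) :=
  ⟨i, ⟨0, hy i⟩⟩

theorem sigma_ext {x z : Σ i : Fin d, Fin (y i)} (h₁ : x.1 = z.1) (h₂ : (x.2 : ℕ) = z.2) :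
    x = z := by
  obtain ⟨i, j⟩ := x
  obtain ⟨k, l⟩ := z
  obtain rfl : i = k := h₁
  exact congrArg _ (Fin.ext h₂)

theorem parent_eq_none {x : Σ i : Fin d, Fin (y i)} : parent x = none ↔ (x.2 : ℕ) = 0 := by
  unfold parent
  split_ifs <;> simp_all

theorem parent_eq_some {x z : Σ i : Fin d, Fin (y i)} :
    parent x = some z ↔ x.1 = z.1 ∧ (x.2 : ℕ) = z.2 + 1 := by
  unfold parent
  split_ifs with h
  · simp only [false_iff]
    omega
  · rw [Option.some_inj]
    constructor
    · rintro rfl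
      exact ⟨rfl, by simp only; omega⟩
    · rintro ⟨h₁, h₂⟩
      exact sigma_ext h₁ (by simp only; omega)

theorem adj_iff {u v : Option (Σ i : Fin d, Fin (y i))} :
    (spider d y).Adj u v ↔
      (∃ x, u = parent x ∧ v = some x) ∨ ∃ x, v = parent x ∧ u = some x := by
  have key : ∀ u v : Option (Σ i : Fin d, Fin (y i)),
      (∃ (i : Fin d) (j : Fin (y i)), (u = none ∧ v = some ⟨i, j⟩ ∧ (j : ℕ) = 0) ∨
        (∃ k : Fin (y i), u = some ⟨i, j⟩ ∧ v = some ⟨i, k⟩ ∧ (j : ℕ) + 1 = (k : ℕ))) ↔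
      ∃ x, u = parent x ∧ v = some x := by
    intro u v
    constructor
    · rintro ⟨i, j, ⟨rfl, rfl, h⟩ | ⟨k, rfl, rfl, h⟩⟩
      · exact ⟨⟨i, j⟩, (parent_eq_none.2 h).symm, rfl⟩
      · exact ⟨⟨i, k⟩, ((parent_eq_some (x := ⟨i, k⟩) (z := ⟨i, j⟩)).2 ⟨rfl, h.symm⟩).symm, rfl⟩
    · rintro ⟨⟨i, k⟩, rfl, rfl⟩
      by_cases h : (k : ℕ) = 0
      · exact ⟨i, k, Or.inl ⟨parent_eq_none.2 h, rfl, h⟩⟩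
      · refine ⟨i, ⟨k - 1, by omega⟩, Or.inr ⟨k, parent_eq_some.2 ⟨rfl, ?_⟩, rfl, ?_⟩⟩ <;>
          simp only <;> omega
  have parent_ne : ∀ x : Σ i : Fin d, Fin (y i), parent x ≠ some x := by
    intro x h
    have := (parent_eq_some.1 h).2
    omega
  rw [spider, SimpleGraph.fromRel_adj, key, key, and_iff_right_iff_imp]
  rintro (⟨x, rfl, rfl⟩ | ⟨x, rfl, rfl⟩)
  exacts [parent_ne x, (parent_ne x).symm]

theorem adj_parent (x : Σ i : Fin d, Fin (y i)) : (spider d y).Adj (parent x) (some x) :=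
  adj_iff.2 (Or.inl ⟨x, rfl, rfl⟩)

theorem edgeSet_eq : (spider d y).edgeSet = Set.range (parentEdge (y := y)) := by
  ext e
  induction e using Sym2.ind with
  | _ u v =>
    rw [SimpleGraph.mem_edgeSet, adj_iff]
    constructor
    · rintro (⟨x, rfl, rfl⟩ | ⟨x, rfl, rfl⟩)
      exacts [⟨x, rfl⟩, ⟨x, Sym2.eq_swap⟩]
    · rintro ⟨x, hx⟩
      rcases Sym2.eq_iff.1 hx with ⟨rfl, rfl⟩ | ⟨rfl, rfl⟩
      exacts [Or.inl ⟨x, rfl, rfl⟩, Or.inr ⟨x, rfl, rfl⟩]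

theorem parentEdge_injective : Function.Injective (parentEdge (y := y)) := by
  intro x z h
  rcases Sym2.eq_iff.1 h with ⟨-, h⟩ | ⟨h, h'⟩
  · exact Option.some_inj.1 h
  · have h₁ := (parent_eq_some.1 h).2
    have h₂ := (parent_eq_some.1 h'.symm).2
    omega

theorem ncard_edgeSet : (spider d y).edgeSet.ncard = ∑ i, y i := by
  rw [edgeSet_eq, ← Set.image_univ, Set.ncard_image_of_injective _ parentEdge_injective,
    Set.ncard_univ, Nat.card_eq_fintype_card]
  simp

theorem vertexSum_none (hy : ∀ i, 1 ≤ y i) (f : Sym2 (Option (Σ i : Fin d, Fin (y i))) → ℕ) :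
    vertexSum (spider d y) f none = ∑ i, f (parentEdge (base hy i)) := by
  have parent_base : ∀ i, parent (base hy i) = none := fun i => parent_eq_none.2 rfl
  have hn : (spider d y).neighborSet none = Set.range fun i => some (base hy i) := by
    ext v
    rw [SimpleGraph.mem_neighborSet, adj_iff]
    constructor
    · rintro (⟨x, h, rfl⟩ | ⟨x, -, h⟩)
      · exact ⟨x.1, congrArg some (sigma_ext rfl (parent_eq_none.1 h.symm).symm)⟩
      · simp at h
    · rintro ⟨i, rfl⟩
      exact Or.inl ⟨_, (parent_base i).symm, rfl⟩
  have hinj : Function.Injective fun i => some (base hy i) := fun i k h =>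
    congrArg Sigma.fst (Option.some_inj.1 h)
  rw [vertexSum, hn, finsum_mem_range hinj, finsum_eq_sum_of_fintype]
  simp only [parentEdge, parent_base]

theorem vertexSum_leaf {x : Σ i : Fin d, Fin (y i)} (hx : (x.2 : ℕ) + 1 = y x.1)
    (f : Sym2 (Option (Σ i : Fin d, Fin (y i))) → ℕ) :
    vertexSum (spider d y) f (some x) = f (parentEdge x) := by
  have hn : (spider d y).neighborSet (some x) = {parent x} := by
    ext v
    rw [SimpleGraph.mem_neighborSet, adj_iff, Set.mem_singleton_iff]
    constructor
    · rintro (⟨⟨i, j⟩, h, rfl⟩ | ⟨z, rfl, h⟩)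
      · obtain ⟨rfl, h₂⟩ := parent_eq_some.1 h.symm
        simp only at h₂
        omega
      · rw [Option.some_inj.1 h]
    · rintro rfl
      exact Or.inr ⟨x, rfl, rfl⟩
  rw [vertexSum, hn, finsum_mem_singleton, parentEdge, Sym2.eq_swap]

theorem vertexSum_of_parent_eq {x z : Σ i : Fin d, Fin (y i)} (hz : parent z = some x)
    (f : Sym2 (Option (Σ i : Fin d, Fin (y i))) → ℕ) :
    vertexSum (spider d y) f (some x) = f (parentEdge x) + f (parentEdge z) := by
  have hzx := parent_eq_some.1 hz
  have hn : (spider d y).neighborSet (some x) = {parent x, some z} := by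
    ext v
    rw [SimpleGraph.mem_neighborSet, adj_iff, Set.mem_insert_iff, Set.mem_singleton_iff]
    constructor
    · rintro (⟨w, h, rfl⟩ | ⟨w, rfl, h⟩)
      · have h := parent_eq_some.1 h.symm
        exact Or.inr (congrArg some (sigma_ext (h.1.trans hzx.1.symm) (h.2.trans hzx.2.symm)))
      · rw [Option.some_inj.1 h]
        exact Or.inl rfl
    · rintro (rfl | rfl)
      · exact Or.inr ⟨x, rfl, rfl⟩
      · exact Or.inl ⟨z, hz.symm, rfl⟩
  have hne : parent x ≠ some z := by
    intro h
    have := (parent_eq_some.1 h).2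
    omega
  rw [vertexSum, hn, finsum_mem_pair hne, parentEdge, parentEdge, hz, Sym2.eq_swap]

theorem leaf_or_exists_child (x : Σ i : Fin d, Fin (y i)) :
    (x.2 : ℕ) + 1 = y x.1 ∨ ∃ z, parent z = some x := by
  by_cases h : (x.2 : ℕ) + 1 = y x.1
  · exact Or.inl h
  · exact Or.inr ⟨⟨x.1, ⟨x.2 + 1, by omega⟩⟩, parent_eq_some.2 ⟨rfl, rfl⟩⟩

theorem lt_vertexSum_parent (hd : 2 ≤ d) (hy : ∀ i, 1 ≤ y i)
    {f : Sym2 (Option (Σ i : Fin d, Fin (y i))) → ℕ} (hf : ∀ x, 1 ≤ f (parentEdge x))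
    (x : Σ i : Fin d, Fin (y i)) :
    f (parentEdge x) < vertexSum (spider d y) f (parent x) := by
  rcases hp : parent x with _ | w
  · have hx : x = base hy x.1 := sigma_ext rfl (parent_eq_none.1 hp)
    rw [vertexSum_none hy]
    have : Nontrivial (Fin d) := Fin.nontrivial_iff_two_le.2 hd
    obtain ⟨k, hk⟩ := exists_ne x.1
    calc f (parentEdge x) = f (parentEdge (base hy x.1)) := by rw [← hx]
      _ < f (parentEdge (base hy x.1)) + f (parentEdge (base hy k)) :=
        Nat.lt_add_of_pos_right (hf _)
      _ ≤ _ := Finset.add_le_sum (f := fun i => f (parentEdge (base hy i)))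
        (fun _ _ => Nat.zero_le _) (Finset.mem_univ _) (Finset.mem_univ _) hk.symm
  · rw [vertexSum_of_parent_eq hp]
    exact Nat.lt_add_of_pos_left (hf _)

theorem leaf_snd_add_one (hy : ∀ i, 1 ≤ y i) (i : Fin d) :
    ((leaf hy i).2 : ℕ) + 1 = y (leaf hy i).1 :=
  Nat.sub_add_cancel (hy i)

theorem succ_le_colorCount (hd : 2 ≤ d) (hy : ∀ i, 1 ≤ y i)
    {f : Sym2 (Option (Σ i : Fin d, Fin (y i))) → ℕ} (hf : IsLocalAntimagic (spider d y) f) :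
    d + 1 ≤ colorCount (spider d y) f := by
  obtain ⟨⟨hmaps, hinj, hsurj⟩, -⟩ := hf
  have hbound : ∀ x, f (parentEdge x) ∈ Set.Icc 1 (spider d y).edgeSet.ncard := fun x =>
    hmaps (adj_parent x)
  have hmax : (spider d y).edgeSet.ncard ∈ Set.Icc 1 (spider d y).edgeSet.ncard :=
    ⟨(hbound (base hy ⟨0, by omega⟩)).1.trans (hbound _).2, le_rfl⟩
  obtain ⟨e, he, hfe⟩ := hsurj hmax
  rw [edgeSet_eq] at he
  obtain ⟨x, rfl⟩ := he
  have hgt := lt_vertexSum_parent hd hy (fun x => (hbound x).1) x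
  have hleaf : Function.Injective fun i => f (parentEdge (leaf hy i)) := fun i k h =>
    congrArg Sigma.fst (parentEdge_injective (hinj (adj_parent _) (adj_parent _) h))
  have hsub : insert (vertexSum (spider d y) f (parent x))
      (Set.range fun i => f (parentEdge (leaf hy i))) ⊆ Set.range (vertexSum (spider d y) f) := by
    rintro _ (rfl | ⟨i, rfl⟩)
    · exact ⟨_, rfl⟩
    · exact ⟨some (leaf hy i), vertexSum_leaf (leaf_snd_add_one hy i) f⟩
  have hnot : vertexSum (spider d y) f (parent x) ∉
      Set.range fun i => f (parentEdge (leaf hy i)) := by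
    rintro ⟨i, hi⟩
    have := (hbound (leaf hy i)).2
    simp only at hi
    omega
  calc d + 1 = (insert (vertexSum (spider d y) f (parent x))
        (Set.range fun i => f (parentEdge (leaf hy i)))).ncard := by
        rw [Set.ncard_insert_of_notMem hnot (Set.toFinite _), ← Set.image_univ,
          Set.ncard_image_of_injective _ hleaf, Set.ncard_univ, Nat.card_eq_fintype_card,
          Fintype.card_fin]
    _ ≤ _ := Set.ncard_le_ncard hsub (Set.toFinite _)

/-- The zigzag sequence `q, q - 1, 1, q - 2, 2, …`, which enumerates `1, …, q`; after the first
entry, consecutive entries sum alternately to `q` and `q - 1`. -/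
def zigzag (q p : ℕ) : ℕ :=
  if p = 0 then q else if p % 2 = 1 then q - 1 - p / 2 else p / 2

theorem zigzag_mem {q p : ℕ} (h : p < q) : zigzag q p ∈ Set.Icc 1 q := by
  rw [Set.mem_Icc]
  unfold zigzag
  split_ifs <;> omega

theorem zigzag_injOn (q : ℕ) : Set.InjOn (zigzag q) (Set.Iio q) := by
  intro p hp r hr h
  rw [Set.mem_Iio] at hp hr
  unfold zigzag at h
  split_ifs at h <;> omega

theorem zigzag_add_zigzag {q p : ℕ} (hp : 1 ≤ p) (h : p + 1 < q) :
    zigzag q p + zigzag q (p + 1) = if p % 2 = 1 then q else q - 1 := by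
  unfold zigzag
  rw [if_neg (by omega : ¬p = 0), if_neg p.succ_ne_zero]
  split_ifs <;> omega

/-- The total length of the legs preceding leg `i` with respect to the ranking `r`. -/
def offset (y : Fin d → ℕ) (r : Fin d → ℕ) (i : Fin d) : ℕ :=
  ∑ k with r k < r i, y k

/-- The position of a non-core vertex when the legs are listed in order of `r`, each one from its
leaf to the core. -/
def position (r : Fin d → ℕ) (x : Σ i : Fin d, Fin (y i)) : ℕ :=
  offset y r x.1 + (y x.1 - 1 - x.2)

theorem offset_add_le {r : Fin d → ℕ} {i k : Fin d} (h : r i < r k) :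
    offset y r i + y i ≤ offset y r k := by
  unfold offset
  rw [add_comm, ← Finset.sum_insert (by simp)]
  refine Finset.sum_le_sum_of_subset fun l hl => ?_
  rw [Finset.mem_insert, Finset.mem_filter] at hl
  rw [Finset.mem_filter]
  rcases hl with rfl | hl
  exacts [⟨Finset.mem_univ _, h⟩, ⟨Finset.mem_univ _, hl.2.trans h⟩]

theorem offset_add_le_sum (r : Fin d → ℕ) (i : Fin d) :
    offset y r i + y i ≤ ∑ k, y k := by
  unfold offset
  rw [add_comm, ← Finset.sum_insert (by simp)]
  exact Finset.sum_le_sum_of_subset (Finset.subset_univ _)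

theorem position_lt (r : Fin d → ℕ) (x : Σ i : Fin d, Fin (y i)) :
    position r x < ∑ k, y k := by
  have := offset_add_le_sum (y := y) r x.1
  have := x.2.isLt
  unfold position
  omega

theorem position_injective {r : Fin d → ℕ} (hr : Function.Injective r) :
    Function.Injective (position (y := y) r) := by
  intro x z h
  have hx := x.2.isLt
  have hz := z.2.isLt
  unfold position at h
  rcases lt_trichotomy (r x.1) (r z.1) with hlt | heq | hlt
  · have := offset_add_le (y := y) hlt
    omega
  · obtain ⟨i, j⟩ := x
    obtain ⟨k, l⟩ := z
    obtain rfl : i = k := hr heq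
    exact sigma_ext rfl (by simp only at *; omega)
  · have := offset_add_le (y := y) hlt
    omega

theorem position_of_parent_eq {r : Fin d → ℕ} {x z : Σ i : Fin d, Fin (y i)}
    (h : parent z = some x) : position r x = position r z + 1 := by
  obtain ⟨i, j⟩ := x
  obtain ⟨k, l⟩ := z
  obtain ⟨rfl, h⟩ := parent_eq_some.1 h
  have := l.isLt
  simp only [position] at *
  omega

/-- A spider with a leg of length `1` has a listing of its non-core vertices which runs along each
leg towards the core, begins with a leg of length `1`, and continues with a leaf. -/
theorem exists_listing (hd : 2 ≤ d) (hy : ∀ i, 1 ≤ y i) (h1 : ∃ i, y i = 1) :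
    ∃ P : (Σ i : Fin d, Fin (y i)) → ℕ, Function.Injective P ∧ (∀ x, P x < ∑ k, y k) ∧
      (∀ x z, parent z = some x → P x = P z + 1) ∧
      ∃ i₀ i₁, y i₀ = 1 ∧ P (leaf hy i₀) = 0 ∧ P (leaf hy i₁) = 1 := by
  obtain ⟨i₀, h₀⟩ := h1
  let s : Equiv.Perm (Fin d) := Equiv.swap i₀ ⟨0, by omega⟩
  let r : Fin d → ℕ := fun i => s i
  have hr : Function.Injective r := Fin.val_injective.comp s.injective
  have hr₀ : r i₀ = 0 := by simp [r, s]
  have hr₁ : r (s.symm ⟨1, by omega⟩) = 1 := by simp [r]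
  refine ⟨position r, position_injective hr, position_lt r, fun x z => position_of_parent_eq,
    i₀, s.symm ⟨1, by omega⟩, h₀, ?_, ?_⟩
  · simp [position, leaf, offset, hr₀]
  · have : (Finset.univ.filter fun k => r k = 0) = {i₀} := by
      ext k
      rw [Finset.mem_filter, Finset.mem_singleton, ← hr.eq_iff, hr₀]
      simp
    simp [position, leaf, offset, hr₁, this, h₀]

theorem exists_isLocalAntimagic (hd : 2 ≤ d) (hy : ∀ i, 1 ≤ y i) (h1 : ∃ i, y i = 1) :
    ∃ f, IsLocalAntimagic (spider d y) f ∧ colorCount (spider d y) f ≤ d + 1 := by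
  obtain ⟨P, hinj, hlt, hstep, i₀, i₁, h₀, hP₀, hP₁⟩ := exists_listing hd hy h1
  set q := ∑ k, y k
  let f : Sym2 (Option (Σ i : Fin d, Fin (y i))) → ℕ :=
    Function.extend parentEdge (fun x => zigzag q (P x)) 0
  have hf : ∀ x, f (parentEdge x) = zigzag q (P x) := fun x =>
    parentEdge_injective.extend_apply _ _ x
  have hmem : ∀ x, f (parentEdge x) ∈ Set.Icc 1 q := fun x => hf x ▸ zigzag_mem (hlt x)
  have hpos : ∀ x z, parent z = some x → 1 ≤ P z := by
    intro x z h
    by_contra! hz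
    obtain rfl : z = leaf hy i₀ := hinj (by omega)
    have := (parent_eq_some.1 h).2
    simp only [leaf] at this
    omega
  have hinner : ∀ x z, parent z = some x →
      vertexSum (spider d y) f (some x) = if P z % 2 = 1 then q else q - 1 := by
    intro x z h
    have hx := hlt x
    rw [hstep x z h] at hx
    rw [vertexSum_of_parent_eq h, hf, hf, hstep x z h, add_comm,
      zigzag_add_zigzag (hpos x z h) hx]
  have hle : ∀ x, vertexSum (spider d y) f (some x) ≤ q := by
    intro x
    rcases leaf_or_exists_child x with h | ⟨z, h⟩
    · rw [vertexSum_leaf h]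
      exact (hmem x).2
    · rw [hinner x z h]
      split_ifs <;> omega
  have hlabel₀ : f (parentEdge (leaf hy i₀)) = q := by simp [hf, hP₀, zigzag]
  have hlabel₁ : f (parentEdge (leaf hy i₁)) = q - 1 := by simp [hf, hP₁, zigzag]
  have hcore : q < vertexSum (spider d y) f none := by
    have hp : parent (leaf hy i₀) = none := parent_eq_none.2 (by simp [leaf, h₀])
    have := lt_vertexSum_parent hd hy (fun x => (hmem x).1) (leaf hy i₀)
    rwa [hp, hlabel₀] at this
  have hne : ∀ x, vertexSum (spider d y) f (parent x) ≠ vertexSum (spider d y) f (some x) := by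
    intro x
    rcases leaf_or_exists_child x with h | ⟨z, h⟩
    · rw [vertexSum_leaf h]
      exact (lt_vertexSum_parent hd hy (fun x => (hmem x).1) x).ne'
    · rcases hp : parent x with _ | w
      · exact ((hle x).trans_lt hcore).ne'
      · rw [hinner w x hp, hinner x z h, hstep x z h]
        have := (hmem x).1.trans (hmem x).2
        split_ifs <;> omega
  refine ⟨f, ⟨?_, ?_⟩, ?_⟩
  · have hmaps : Set.MapsTo f (spider d y).edgeSet (Set.Icc 1 (spider d y).edgeSet.ncard) := by
      rw [ncard_edgeSet, edgeSet_eq]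
      rintro _ ⟨x, rfl⟩
      exact hmem x
    have hinjOn : Set.InjOn f (spider d y).edgeSet := by
      rw [edgeSet_eq]
      rintro _ ⟨x, rfl⟩ _ ⟨z, rfl⟩ h
      rw [hf, hf] at h
      rw [hinj (zigzag_injOn q (hlt x) (hlt z) h)]
    refine ⟨hmaps, hinjOn, ?_⟩
    rw [Set.SurjOn, Set.eq_of_subset_of_ncard_le hmaps.image_subset _ (Set.finite_Icc _ _)]
    rw [hinjOn.ncard_image, Set.ncard_eq_toFinset_card', Set.toFinset_Icc,
      Nat.card_Icc, Nat.add_sub_cancel]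
  · intro u v huv
    rcases adj_iff.1 huv with ⟨x, rfl, rfl⟩ | ⟨x, rfl, rfl⟩
    exacts [hne x, (hne x).symm]
  · have hsub : Set.range (vertexSum (spider d y) f) ⊆
        insert (vertexSum (spider d y) f none)
          (Set.range fun i => f (parentEdge (leaf hy i))) := by
      rintro _ ⟨_ | x, rfl⟩
      · exact Or.inl rfl
      · refine Or.inr ?_
        rcases leaf_or_exists_child x with h | ⟨z, h⟩
        · refine ⟨x.1, ?_⟩
          have hx : leaf hy x.1 = x := sigma_ext rfl (by simp only [leaf]; omega)
          rw [vertexSum_leaf h]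
          exact congrArg (fun w => f (parentEdge w)) hx
        · rw [hinner x z h]
          split_ifs
          exacts [⟨i₀, hlabel₀⟩, ⟨i₁, hlabel₁⟩]
    calc colorCount (spider d y) f ≤ _ := Set.ncard_le_ncard hsub (Set.toFinite _)
      _ ≤ (Set.range fun i => f (parentEdge (leaf hy i))).ncard + 1 := Set.ncard_insert_le _ _
      _ ≤ d + 1 := by
        rw [← Set.image_univ]
        refine Nat.add_le_add_right ((Set.ncard_image_le Set.finite_univ).trans ?_) 1
        rw [Set.ncard_univ, Nat.card_eq_fintype_card, Fintype.card_fin]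

end Spider

theorem stmt3 (d : ℕ) (hd : 3 ≤ d) (y : Fin d → ℕ) (hy : ∀ i, 1 ≤ y i)
    (h1 : ∃ i, y i = 1) : chiLA (spider d y) = d + 1 := by
  have hd₂ : 2 ≤ d := by omega
  obtain ⟨f, hf, hcount⟩ := Spider.exists_isLocalAntimagic hd₂ hy h1
  have hmem : colorCount (spider d y) f ∈
      {n | ∃ f, IsLocalAntimagic (spider d y) f ∧ colorCount (spider d y) f = n} := ⟨f, hf, rfl⟩
  refine le_antisymm ((Nat.sInf_le hmem).trans hcount) (le_csInf ⟨_, hmem⟩ ?_)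
  rintro _ ⟨g, hg, rfl⟩
  exact Spider.succ_le_colorCount hd₂ hy hg
end

section
/- Let y₁,…,y_d ≥ 2 be even positive integers with d ≥ 2 satisfying y_d = y_{d−2} + 2y_{d−3} + ⋯ + (d−3)y₂ + (d−2)y₁, equivalently Σ_{i=1}^{d} (d−i−1)y_i = 0. Then the spider Sp(y₁,…,y_d) has local antimagic chromatic number d+1. -/
open SimpleGraph

/-- The predecessor of a non-core vertex of a spider on the path towards the core. -/
def spiderParent {d : ℕ} {y : Fin d → ℕ} (v : Σ i : Fin d, Fin (y i)) :
    Option (Σ i : Fin d, Fin (y i)) :=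
  if (v.2 : ℕ) = 0 then none else some ⟨v.1, ⟨v.2 - 1, by omega⟩⟩

/-- The edge of a spider joining a non-core vertex to its predecessor. -/
def spiderEdge {d : ℕ} {y : Fin d → ℕ} (v : Σ i : Fin d, Fin (y i)) :
    Sym2 (Option (Σ i : Fin d, Fin (y i))) :=
  s(some v, spiderParent v)

lemma sigma_fin_mk_congr {d : ℕ} {y : Fin d → ℕ} {i : Fin d} {j k : Fin (y i)}
    (h : (j : ℕ) = k) : (⟨i, j⟩ : Σ i : Fin d, Fin (y i)) = ⟨i, k⟩ := by
  rw [Fin.ext h]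

lemma spiderParent_eq_none {d : ℕ} {y : Fin d → ℕ} {v : Σ i : Fin d, Fin (y i)} :
    spiderParent v = none ↔ (v.2 : ℕ) = 0 := by
  simp [spiderParent]

lemma spiderParent_eq_some {d : ℕ} {y : Fin d → ℕ} {v : Σ i : Fin d, Fin (y i)}
    {i : Fin d} {j : Fin (y i)} :
    spiderParent v = some ⟨i, j⟩ ↔ ∃ h : (j : ℕ) + 1 < y i, v = ⟨i, ⟨j + 1, h⟩⟩ := by
  obtain ⟨k, l⟩ := v
  unfold spiderParent
  split_ifs with hl
  · simp only [false_iff, not_exists]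
    rintro h heq
    obtain ⟨rfl, h2⟩ := Sigma.mk.inj_iff.1 heq
    have := congrArg Fin.val (eq_of_heq h2)
    simp_all
  · constructor
    · intro h
      obtain ⟨rfl, h2⟩ := Sigma.mk.inj_iff.1 (Option.some.inj h)
      have h3 := congrArg Fin.val (eq_of_heq h2)
      dsimp only at h3 hl
      have hlt := l.2
      exact ⟨by dsimp only; omega, sigma_fin_mk_congr (by dsimp only; omega)⟩
    · rintro ⟨h, heq⟩
      obtain ⟨rfl, h2⟩ := Sigma.mk.inj_iff.1 heq
      have h3 := eq_of_heq h2
      subst h3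
      simp

lemma spider_adj_some {d : ℕ} {y : Fin d → ℕ} {v : Σ i : Fin d, Fin (y i)}
    {w : Option (Σ i : Fin d, Fin (y i))} :
    (spider d y).Adj w (some v) ↔
      w = spiderParent v ∨ ∃ u, w = some u ∧ spiderParent u = some v := by
  obtain ⟨i, j⟩ := v
  unfold spider
  rw [SimpleGraph.fromRel_adj]
  constructor
  · rintro ⟨-, ⟨k, l, ⟨rfl, h, hl⟩ | ⟨m, rfl, h, hm⟩⟩ | ⟨k, l, ⟨h, -, hl⟩ | ⟨m, h, rfl, hm⟩⟩⟩
    · rw [Option.some.inj h]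
      exact Or.inl (spiderParent_eq_none.2 hl).symm
    · rw [Option.some.inj h]
      exact Or.inl (spiderParent_eq_some.2 ⟨by omega, sigma_fin_mk_congr hm.symm⟩).symm
    · cases h
    · rw [Option.some.inj h]
      exact Or.inr ⟨_, rfl, spiderParent_eq_some.2 ⟨by omega, sigma_fin_mk_congr hm.symm⟩⟩
  · rintro (rfl | ⟨u, rfl, hu⟩)
    · unfold spiderParent
      split_ifs with hj
      · exact ⟨by simp, Or.inl ⟨i, j, Or.inl ⟨rfl, rfl, hj⟩⟩⟩
      · dsimp only at hj
        refine ⟨?_, Or.inl ⟨i, ⟨j - 1, by omega⟩, Or.inr ⟨j, rfl, rfl, ?_⟩⟩⟩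
        · intro h
          have h3 := congrArg Fin.val (eq_of_heq (Sigma.mk.inj_iff.1 (Option.some.inj h)).2)
          dsimp only at h3
          omega
        · dsimp only
          omega
    · obtain ⟨h, rfl⟩ := spiderParent_eq_some.1 hu
      refine ⟨?_, Or.inr ⟨i, j, Or.inr ⟨_, rfl, rfl, rfl⟩⟩⟩
      intro h
      have h3 := congrArg Fin.val (eq_of_heq (Sigma.mk.inj_iff.1 (Option.some.inj h)).2)
      simp at h3

lemma spider_not_adj_none (d : ℕ) (y : Fin d → ℕ) : ¬ (spider d y).Adj none none :=
  SimpleGraph.irrefl _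

lemma spiderEdge_injective (d : ℕ) (y : Fin d → ℕ) :
    Function.Injective (spiderEdge : (Σ i : Fin d, Fin (y i)) → _) := by
  rintro ⟨i, j⟩ ⟨k, l⟩ h
  rcases Sym2.eq_iff.1 h with ⟨h1, -⟩ | ⟨h1, h2⟩
  · exact Option.some.inj h1
  · obtain ⟨_, h3⟩ := spiderParent_eq_some.1 h1.symm
    obtain ⟨rfl, h4⟩ := Sigma.mk.inj_iff.1 h3
    obtain ⟨_, h5⟩ := spiderParent_eq_some.1 h2
    have h6 := congrArg Fin.val (eq_of_heq (Sigma.mk.inj_iff.1 h5).2)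
    have h7 := congrArg Fin.val (eq_of_heq h4)
    dsimp only at h6 h7
    omega

lemma spider_edgeSet (d : ℕ) (y : Fin d → ℕ) : (spider d y).edgeSet = Set.range spiderEdge := by
  ext e
  induction e using Sym2.ind with
  | _ u v =>
    rw [SimpleGraph.mem_edgeSet]
    constructor
    · intro h
      cases v with
      | some v =>
        rcases spider_adj_some.1 h with rfl | ⟨u, rfl, hu⟩
        · exact ⟨v, Sym2.eq_swap⟩
        · exact ⟨u, by rw [spiderEdge, hu]⟩
      | none =>
        cases u with
        | none => exact (spider_not_adj_none d y h).elim
        | some u =>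
          rcases spider_adj_some.1 h.symm with hu | ⟨_, h', -⟩
          · exact ⟨u, by rw [spiderEdge, ← hu]⟩
          · cases h'
    · rintro ⟨w, hw⟩
      rw [← SimpleGraph.mem_edgeSet, ← hw]
      exact (spider_adj_some.2 (Or.inl rfl)).symm

lemma spider_edgeSet_ncard (d : ℕ) (y : Fin d → ℕ) :
    (spider d y).edgeSet.ncard = ∑ i, y i := by
  rw [spider_edgeSet, Set.ncard_range_of_injective (spiderEdge_injective d y)]
  simp

lemma vertexSum_spider_none {d : ℕ} {y : Fin d → ℕ} (hy : ∀ i, 0 < y i)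
    (f : Sym2 (Option (Σ i : Fin d, Fin (y i))) → ℕ) :
    vertexSum (spider d y) f none = ∑ i, f (spiderEdge ⟨i, ⟨0, hy i⟩⟩) := by
  have h : (spider d y).neighborSet none =
      Set.range fun i : Fin d => (some ⟨i, ⟨0, hy i⟩⟩ : Option (Σ i : Fin d, Fin (y i))) := by
    ext w
    rw [SimpleGraph.mem_neighborSet]
    cases w with
    | none => simp
    | some v =>
      obtain ⟨i, j⟩ := v
      rw [spider_adj_some, eq_comm, spiderParent_eq_none]
      constructor
      · rintro (hj | ⟨_, h, -⟩)
        · exact ⟨i, congrArg some (sigma_fin_mk_congr hj.symm)⟩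
        · cases h
      · rintro ⟨k, hk⟩
        obtain ⟨rfl, h2⟩ := Sigma.mk.inj_iff.1 (Option.some.inj hk)
        exact Or.inl (congrArg Fin.val (eq_of_heq h2)).symm
  have hinj : Function.Injective
      fun i : Fin d => (some ⟨i, ⟨0, hy i⟩⟩ : Option (Σ i : Fin d, Fin (y i))) :=
    fun i j hij => (Sigma.mk.inj_iff.1 (Option.some.inj hij)).1
  rw [vertexSum, h, finsum_mem_range hinj, finsum_eq_sum_of_fintype]
  refine Finset.sum_congr rfl fun i _ => ?_
  rw [spiderEdge, spiderParent_eq_none.2 rfl, Sym2.eq_swap]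

lemma vertexSum_spider_inner {d : ℕ} {y : Fin d → ℕ}
    (f : Sym2 (Option (Σ i : Fin d, Fin (y i))) → ℕ) (i : Fin d) (j : ℕ) (hj : j + 1 < y i) :
    vertexSum (spider d y) f (some ⟨i, ⟨j, by omega⟩⟩) =
      f (spiderEdge ⟨i, ⟨j, by omega⟩⟩) + f (spiderEdge ⟨i, ⟨j + 1, hj⟩⟩) := by
  have hp : spiderParent (⟨i, ⟨j + 1, hj⟩⟩ : Σ i : Fin d, Fin (y i)) =
    some ⟨i, ⟨j, by omega⟩⟩ := spiderParent_eq_some.2 ⟨hj, rfl⟩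
  have h : (spider d y).neighborSet (some ⟨i, ⟨j, by omega⟩⟩) =
      {spiderParent ⟨i, ⟨j, by omega⟩⟩, some ⟨i, ⟨j + 1, hj⟩⟩} := by
    ext w
    rw [SimpleGraph.mem_neighborSet, SimpleGraph.adj_comm, spider_adj_some]
    refine or_congr Iff.rfl ⟨?_, ?_⟩
    · rintro ⟨u, rfl, hu⟩
      obtain ⟨_, rfl⟩ := spiderParent_eq_some.1 hu
      rfl
    · rintro rfl
      exact ⟨_, rfl, hp⟩
  have hne : spiderParent (⟨i, ⟨j, by omega⟩⟩ : Σ i : Fin d, Fin (y i)) ≠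
      some ⟨i, ⟨j + 1, hj⟩⟩ := by
    intro h
    obtain ⟨_, h2⟩ := spiderParent_eq_some.1 h
    have h3 := congrArg Fin.val (eq_of_heq (Sigma.mk.inj_iff.1 h2).2)
    dsimp only at h3
    omega
  rw [vertexSum, h, finsum_mem_pair hne]
  congr 2
  rw [spiderEdge, hp, Sym2.eq_swap]

lemma vertexSum_spider_leaf {d : ℕ} {y : Fin d → ℕ}
    (f : Sym2 (Option (Σ i : Fin d, Fin (y i))) → ℕ) (i : Fin d) (j : Fin (y i))
    (hj : (j : ℕ) + 1 = y i) :
    vertexSum (spider d y) f (some ⟨i, j⟩) = f (spiderEdge ⟨i, j⟩) := by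
  have h : (spider d y).neighborSet (some ⟨i, j⟩) = {spiderParent ⟨i, j⟩} := by
    ext w
    rw [SimpleGraph.mem_neighborSet, SimpleGraph.adj_comm, spider_adj_some]
    refine ⟨?_, Or.inl⟩
    rintro (h | ⟨u, rfl, hu⟩)
    · exact h
    · obtain ⟨h, -⟩ := spiderParent_eq_some.1 hu
      omega
  rw [vertexSum, h, finsum_mem_singleton, spiderEdge]

/-- The leaf at the end of each leg of a spider. -/
def spiderLeaf {d : ℕ} {y : Fin d → ℕ} (hy : ∀ i, 2 ≤ y i) (i : Fin d) :
    Σ i : Fin d, Fin (y i) :=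
  ⟨i, ⟨y i - 1, by have := hy i; omega⟩⟩

lemma vertexSum_spiderLeaf {d : ℕ} {y : Fin d → ℕ} (hy : ∀ i, 2 ≤ y i)
    (f : Sym2 (Option (Σ i : Fin d, Fin (y i))) → ℕ) (i : Fin d) :
    vertexSum (spider d y) f (some (spiderLeaf hy i)) = f (spiderEdge (spiderLeaf hy i)) :=
  vertexSum_spider_leaf f _ _ (by have := hy i; dsimp only; omega)

lemma spiderLeaf_injective {d : ℕ} {y : Fin d → ℕ} (hy : ∀ i, 2 ≤ y i) :
    Function.Injective (spiderLeaf hy) :=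
  fun _ _ h => (Sigma.mk.inj_iff.1 h).1

/-- Some vertex on the edge carrying the largest label is not a leaf, so its sum exceeds that
label. -/
lemma exists_lt_vertexSum_spider {d : ℕ} {y : Fin d → ℕ} (hy : ∀ i, 2 ≤ y i)
    {f : Sym2 (Option (Σ i : Fin d, Fin (y i))) → ℕ}
    (hf : ∀ v, 0 < f (spiderEdge v)) (v : Σ i : Fin d, Fin (y i)) :
    ∃ x, f (spiderEdge v) < vertexSum (spider d y) f x := by
  obtain ⟨i, j, hj⟩ := v
  by_cases hlast : j + 1 < y i
  · refine ⟨some ⟨i, ⟨j, hj⟩⟩, ?_⟩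
    rw [vertexSum_spider_inner f i j hlast]
    have := hf ⟨i, ⟨j + 1, hlast⟩⟩
    omega
  · have h2 := hy i
    obtain ⟨k, rfl⟩ : ∃ k, j = k + 1 := ⟨j - 1, by omega⟩
    refine ⟨some ⟨i, ⟨k, by omega⟩⟩, ?_⟩
    rw [vertexSum_spider_inner f i k hj]
    have := hf ⟨i, ⟨k, by omega⟩⟩
    omega

lemma le_colorCount_spider {d : ℕ} (hd : 0 < d) {y : Fin d → ℕ} (hy : ∀ i, 2 ≤ y i)
    {f : Sym2 (Option (Σ i : Fin d, Fin (y i))) → ℕ}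
    (hf : Set.BijOn f (spider d y).edgeSet (Set.Icc 1 (spider d y).edgeSet.ncard)) :
    d + 1 ≤ colorCount (spider d y) f := by
  have hmem (v) : spiderEdge v ∈ (spider d y).edgeSet := by
    rw [spider_edgeSet]; exact ⟨v, rfl⟩
  have hle (v) := hf.mapsTo (hmem v)
  have hpos : 1 ≤ (spider d y).edgeSet.ncard :=
    (hle (spiderLeaf hy ⟨0, hd⟩)).1.trans (hle _).2
  obtain ⟨e, he, hfe⟩ := hf.surjOn (Set.right_mem_Icc.2 hpos)
  rw [spider_edgeSet] at he
  obtain ⟨v, rfl⟩ := he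
  obtain ⟨x, hx⟩ := exists_lt_vertexSum_spider hy (fun v => (hle v).1) v
  rw [hfe] at hx
  have hinj : Function.Injective fun i => f (spiderEdge (spiderLeaf hy i)) := fun i j hij =>
    spiderLeaf_injective hy (spiderEdge_injective d y (hf.injOn (hmem _) (hmem _) hij))
  have hnot : vertexSum (spider d y) f x ∉
      Set.range fun i => f (spiderEdge (spiderLeaf hy i)) := by
    rintro ⟨i, hi⟩
    have := (hle (spiderLeaf hy i)).2
    dsimp only at hi
    omega
  calc d + 1 = (insert (vertexSum (spider d y) f x)
        (Set.range fun i => f (spiderEdge (spiderLeaf hy i)))).ncard := by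
        rw [Set.ncard_insert_of_notMem hnot, Set.ncard_range_of_injective hinj, Nat.card_fin]
    _ ≤ _ := by
        refine Set.ncard_le_ncard ?_ (Set.finite_range _)
        rw [Set.insert_subset_iff]
        refine ⟨⟨x, rfl⟩, ?_⟩
        rintro _ ⟨i, rfl⟩
        exact ⟨_, vertexSum_spiderLeaf hy f i⟩

/-- The label given to the edge below each non-core vertex of a spider with legs of length
`2 * h i`: on leg `i` the labels at even positions decrease from `∑ k ≤ i, h k`, and consecutive
labels sum alternately to `2 * ∑ k, h k + 1` and `2 * ∑ k, h k`. -/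
def spiderLabel {d : ℕ} (h : Fin d → ℕ) (v : Σ i : Fin d, Fin (2 * h i)) : ℕ :=
  if (v.2 : ℕ) % 2 = 0 then ∑ k ∈ Finset.Iic v.1, h k - v.2 / 2
  else 2 * ∑ k, h k + 1 - (∑ k ∈ Finset.Iic v.1, h k - v.2 / 2)

lemma le_sum_Iic {d : ℕ} (h : Fin d → ℕ) (i : Fin d) : h i ≤ ∑ k ∈ Finset.Iic i, h k :=
  Finset.single_le_sum (f := h) (fun _ _ => Nat.zero_le _) (Finset.mem_Iic.2 le_rfl)

lemma sum_Iic_le_sum {d : ℕ} (h : Fin d → ℕ) (i : Fin d) :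
    ∑ k ∈ Finset.Iic i, h k ≤ ∑ k, h k :=
  Finset.sum_le_sum_of_subset (Finset.subset_univ _)

lemma sum_Iic_add_le {d : ℕ} (h : Fin d → ℕ) {i j : Fin d} (hij : i < j) :
    ∑ k ∈ Finset.Iic i, h k + h j ≤ ∑ k ∈ Finset.Iic j, h k := by
  rw [add_comm, ← Finset.sum_insert (s := Finset.Iic i) (by simpa using hij)]
  refine Finset.sum_le_sum_of_subset fun k hk => ?_
  rcases Finset.mem_insert.1 hk with rfl | hk
  · simp
  · exact Finset.mem_Iic.2 ((Finset.mem_Iic.1 hk).trans hij.le)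

lemma spiderLabel_mem {d : ℕ} (h : Fin d → ℕ) (v : Σ i : Fin d, Fin (2 * h i)) :
    spiderLabel h v ∈ Set.Icc 1 (2 * ∑ k, h k) := by
  obtain ⟨i, j, hj⟩ := v
  have h1 := le_sum_Iic h i
  have h2 := sum_Iic_le_sum h i
  rw [Set.mem_Icc]
  dsimp only [spiderLabel]
  split_ifs <;> omega

lemma spiderLabel_injective {d : ℕ} (h : Fin d → ℕ) : Function.Injective (spiderLabel h) := by
  rintro ⟨i, j, hj⟩ ⟨i', j', hj'⟩ heq
  have h1 := le_sum_Iic h i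
  have h2 := sum_Iic_le_sum h i
  have h1' := le_sum_Iic h i'
  have h2' := sum_Iic_le_sum h i'
  dsimp only [spiderLabel] at heq
  rcases lt_trichotomy i i' with hi | rfl | hi
  · have := sum_Iic_add_le h hi
    split_ifs at heq <;> omega
  · have : j = j' := by split_ifs at heq <;> omega
    subst this
    rfl
  · have := sum_Iic_add_le h hi
    split_ifs at heq <;> omega

lemma spiderLabel_bijOn {d : ℕ} (h : Fin d → ℕ) :
    Set.BijOn (spiderLabel h) Set.univ (Set.Icc 1 (2 * ∑ k, h k)) := by
  refine ⟨fun v _ => spiderLabel_mem h v, (spiderLabel_injective h).injOn, ?_⟩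
  have hsub : Set.range (spiderLabel h) ⊆ Set.Icc 1 (2 * ∑ k, h k) := by
    rintro _ ⟨v, rfl⟩
    exact spiderLabel_mem h v
  rw [Set.SurjOn, Set.image_univ]
  refine (Set.eq_of_subset_of_ncard_le hsub ?_ (Set.finite_Icc _ _)).ge
  rw [Set.ncard_range_of_injective (spiderLabel_injective h)]
  simp [Set.ncard_eq_toFinset_card', Finset.mul_sum]

lemma sum_sum_Iic {d : ℕ} (h : Fin d → ℕ) :
    ∑ i, ∑ k ∈ Finset.Iic i, h k = ∑ k : Fin d, (d - k) * h k := by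
  rw [Finset.sum_comm' (t' := Finset.univ) (s' := fun k => Finset.Ici k) (by simp)]
  simp

/-- The labeling of a spider which agrees with `spiderLabel` on the edges. -/
noncomputable def spiderLabeling {d : ℕ} (h : Fin d → ℕ) :
    Sym2 (Option (Σ i : Fin d, Fin (2 * h i))) → ℕ :=
  Function.extend spiderEdge (spiderLabel h) 0

lemma spiderLabeling_edge {d : ℕ} (h : Fin d → ℕ) (v : Σ i : Fin d, Fin (2 * h i)) :
    spiderLabeling h (spiderEdge v) = spiderLabel h v :=
  (spiderEdge_injective d _).extend_apply _ _ _

lemma spiderLabeling_bijOn {d : ℕ} (h : Fin d → ℕ) :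
    Set.BijOn (spiderLabeling h) (spider d fun i => 2 * h i).edgeSet
      (Set.Icc 1 (spider d fun i => 2 * h i).edgeSet.ncard) := by
  have hb := spiderLabel_bijOn h
  rw [spider_edgeSet_ncard, spider_edgeSet, ← Finset.mul_sum]
  refine ⟨?_, ?_, ?_⟩
  · rintro _ ⟨v, rfl⟩
    rw [spiderLabeling_edge]
    exact spiderLabel_mem h v
  · rintro _ ⟨v, rfl⟩ _ ⟨w, rfl⟩ hvw
    rw [spiderLabeling_edge, spiderLabeling_edge] at hvw
    rw [spiderLabel_injective h hvw]
  · intro n hn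
    obtain ⟨v, -, rfl⟩ := hb.surjOn hn
    exact ⟨_, ⟨v, rfl⟩, spiderLabeling_edge h v⟩

lemma vertexSum_spiderLabeling_even {d : ℕ} (h : Fin d → ℕ) (i : Fin d) (j : Fin (2 * h i))
    (hj : (j : ℕ) % 2 = 0) :
    vertexSum (spider d fun i => 2 * h i) (spiderLabeling h) (some ⟨i, j⟩) =
      2 * ∑ k, h k + 1 := by
  obtain ⟨j, hlt⟩ := j
  dsimp only at hj
  rw [vertexSum_spider_inner _ i j (by omega), spiderLabeling_edge, spiderLabeling_edge]
  have h1 := le_sum_Iic h i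
  have h2 := sum_Iic_le_sum h i
  dsimp only [spiderLabel]
  split_ifs <;> omega

lemma vertexSum_spiderLabeling_odd {d : ℕ} (h : Fin d → ℕ) (i : Fin d) (j : ℕ)
    (hlt : j + 1 < 2 * h i) (hj : j % 2 = 1) :
    vertexSum (spider d fun i => 2 * h i) (spiderLabeling h) (some ⟨i, ⟨j, by omega⟩⟩) =
      2 * ∑ k, h k := by
  rw [vertexSum_spider_inner _ i j (by omega), spiderLabeling_edge, spiderLabeling_edge]
  have h1 := le_sum_Iic h i
  have h2 := sum_Iic_le_sum h i
  dsimp only [spiderLabel]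
  split_ifs <;> omega

lemma vertexSum_spiderLabeling_none {d : ℕ} {h : Fin d → ℕ} (hpos : ∀ i, 0 < h i)
    (hsum : ∑ i, ∑ k ∈ Finset.Iic i, h k = 2 * ∑ k, h k) :
    vertexSum (spider d fun i => 2 * h i) (spiderLabeling h) none = 2 * ∑ k, h k := by
  rw [vertexSum_spider_none (fun i => by have := hpos i; omega), ← hsum]
  refine Finset.sum_congr rfl fun i _ => ?_
  rw [spiderLabeling_edge]
  simp [spiderLabel]

lemma spiderLabel_lastEdge_zero {d : ℕ} (hd : 0 < d) {h : Fin d → ℕ}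
    (hy : ∀ i, 2 ≤ 2 * h i) :
    spiderLabel h (spiderLeaf hy ⟨0, hd⟩) = 2 * ∑ k, h k := by
  have h1 : ∑ k ∈ Finset.Iic (⟨0, hd⟩ : Fin d), h k = h ⟨0, hd⟩ := by
    rw [← Finset.sum_singleton h ⟨0, hd⟩]
    congr 1
    ext k
    simp [Fin.le_def, Fin.ext_iff]
  have h2 := hy ⟨0, hd⟩
  dsimp only [spiderLabel, spiderLeaf]
  rw [h1]
  split_ifs <;> omega

/-- Every vertex sum is either one more than the number of edges, or at most that number and
occurs at a leaf. -/
lemma vertexSum_spiderLabeling_mem {d : ℕ} (hd : 0 < d) {h : Fin d → ℕ}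
    (hy : ∀ i, 2 ≤ 2 * h i) (hsum : ∑ i, ∑ k ∈ Finset.Iic i, h k = 2 * ∑ k, h k)
    (x : Option (Σ i : Fin d, Fin (2 * h i)))
    (hx : ∀ v, x = some v → (v.2 : ℕ) % 2 = 1) :
    vertexSum (spider d fun i => 2 * h i) (spiderLabeling h) x ∈
      Set.range fun i => spiderLabel h (spiderLeaf hy i) := by
  rcases x with - | ⟨i, j, hj⟩
  · rw [vertexSum_spiderLabeling_none (fun i => by have := hy i; omega) hsum]
    exact ⟨⟨0, hd⟩, spiderLabel_lastEdge_zero hd hy⟩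
  · have hodd : j % 2 = 1 := hx _ rfl
    by_cases hlast : j + 1 < 2 * h i
    · rw [vertexSum_spiderLabeling_odd h i j hlast hodd]
      exact ⟨⟨0, hd⟩, spiderLabel_lastEdge_zero hd hy⟩
    · refine ⟨i, ?_⟩
      obtain rfl : j = 2 * h i - 1 := by omega
      exact ((vertexSum_spiderLeaf hy _ i).trans (spiderLabeling_edge h _)).symm

lemma isLocalAntimagic_spiderLabeling {d : ℕ} (hd : 0 < d) {h : Fin d → ℕ}
    (hy : ∀ i, 2 ≤ 2 * h i) (hsum : ∑ i, ∑ k ∈ Finset.Iic i, h k = 2 * ∑ k, h k) :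
    IsLocalAntimagic (spider d fun i => 2 * h i) (spiderLabeling h) := by
  refine ⟨spiderLabeling_bijOn h, ?_⟩
  have key (v : Σ i : Fin d, Fin (2 * h i)) :
      vertexSum (spider d fun i => 2 * h i) (spiderLabeling h) (some v) ≠
        vertexSum (spider d fun i => 2 * h i) (spiderLabeling h) (spiderParent v) := by
    have hlow (x) (hx : ∀ v, x = some v → (v.2 : ℕ) % 2 = 1) :
        vertexSum (spider d fun i => 2 * h i) (spiderLabeling h) x < 2 * ∑ k, h k + 1 := by
      obtain ⟨i, hi⟩ := vertexSum_spiderLabeling_mem hd hy hsum x hx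
      rw [← hi]
      exact Nat.lt_succ_of_le (spiderLabel_mem h _).2
    obtain ⟨i, j⟩ := v
    rcases Nat.mod_two_eq_zero_or_one j with hj | hj
    · rw [vertexSum_spiderLabeling_even h i j hj]
      refine (hlow _ ?_).ne'
      rintro ⟨k, l⟩ hkl
      obtain ⟨hl, h2⟩ := spiderParent_eq_some.1 hkl
      obtain ⟨rfl, h3⟩ := Sigma.mk.inj_iff.1 h2
      have := congrArg Fin.val (eq_of_heq h3)
      dsimp only at this ⊢
      omega
    · have hp : spiderParent (⟨i, j⟩ : Σ i : Fin d, Fin (2 * h i)) =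
          some ⟨i, ⟨j - 1, by omega⟩⟩ := if_neg (by dsimp only; omega)
      rw [hp, vertexSum_spiderLabeling_even h i ⟨j - 1, by omega⟩ (by dsimp only; omega)]
      refine (hlow _ ?_).ne
      rintro v hv
      rw [← Option.some.inj hv]
      exact hj
  intro x z hxz
  have he : s(x, z) ∈ (spider d fun i => 2 * h i).edgeSet := hxz
  rw [spider_edgeSet] at he
  obtain ⟨v, hv⟩ := he
  rcases Sym2.eq_iff.1 hv with ⟨rfl, rfl⟩ | ⟨rfl, rfl⟩
  · exact key v
  · exact (key v).symm

lemma colorCount_spiderLabeling_le {d : ℕ} (hd : 0 < d) {h : Fin d → ℕ}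
    (hy : ∀ i, 2 ≤ 2 * h i) (hsum : ∑ i, ∑ k ∈ Finset.Iic i, h k = 2 * ∑ k, h k) :
    colorCount (spider d fun i => 2 * h i) (spiderLabeling h) ≤ d + 1 := by
  calc colorCount (spider d fun i => 2 * h i) (spiderLabeling h) ≤
      (insert (2 * ∑ k, h k + 1)
        (Set.range fun i => spiderLabel h (spiderLeaf hy i))).ncard := by
        refine Set.ncard_le_ncard ?_ ((Set.finite_range _).insert _)
        rintro _ ⟨x, rfl⟩
        by_cases hx : ∀ v, x = some v → (v.2 : ℕ) % 2 = 1
        · exact Or.inr (vertexSum_spiderLabeling_mem hd hy hsum x hx)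
        · push Not at hx
          obtain ⟨⟨i, j⟩, rfl, hj⟩ := hx
          exact Or.inl (vertexSum_spiderLabeling_even h i j (by dsimp only at hj; omega))
    _ ≤ (Set.range fun i => spiderLabel h (spiderLeaf hy i)).ncard + 1 := Set.ncard_insert_le _ _
    _ = d + 1 := by
        have hinj : Function.Injective fun i => spiderLabel h (spiderLeaf hy i) :=
          (spiderLabel_injective h).comp (spiderLeaf_injective hy)
        rw [Set.ncard_range_of_injective hinj, Nat.card_fin]

theorem stmt8 (d : ℕ) (hd : 2 ≤ d) (y : Fin d → ℕ)
    (hy : ∀ i, 2 ≤ y i ∧ Even (y i))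
    (hsum : ∑ i : Fin d, ((d : ℤ) - (i : ℕ) - 2) * (y i : ℤ) = 0) :
    chiLA (spider d y) = d + 1 := by
  obtain ⟨h, rfl⟩ : ∃ h : Fin d → ℕ, y = fun i => 2 * h i := by
    choose h hh using fun i => (hy i).2
    exact ⟨h, funext fun i => by rw [hh i]; ring⟩
  have hd0 : 0 < d := by omega
  have hy2 (i) : 2 ≤ 2 * h i := (hy i).1
  have hprefix : ∑ i, ∑ k ∈ Finset.Iic i, h k = 2 * ∑ k, h k := by
    rw [sum_sum_Iic]
    zify
    have hexp : ∑ i : Fin d, ((d : ℤ) - (i : ℕ) - 2) * ((2 * h i : ℕ) : ℤ) =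
        2 * (∑ k : Fin d, ((d - k : ℕ) : ℤ) * (h k : ℤ) - 2 * ∑ k, (h k : ℤ)) := by
      rw [Finset.mul_sum, ← Finset.sum_sub_distrib, Finset.mul_sum]
      refine Finset.sum_congr rfl fun k _ => ?_
      rw [Nat.cast_sub k.2.le]
      push_cast
      ring
    rw [hexp] at hsum
    linarith
  have hla := isLocalAntimagic_spiderLabeling hd0 hy2 hprefix
  have hcount : colorCount (spider d fun i => 2 * h i) (spiderLabeling h) = d + 1 :=
    le_antisymm (colorCount_spiderLabeling_le hd0 hy2 hprefix)
      (le_colorCount_spider hd0 hy2 hla.1)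
  refine le_antisymm (Nat.sInf_le ⟨_, hla, hcount⟩) (le_csInf ⟨_, _, hla, hcount⟩ ?_)
  rintro n ⟨f, hf, rfl⟩
  exact le_colorCount_spider hd0 hy2 hf.1
end
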